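/- (Fast decodability.) Let A_1, …, A_N ∈ ℂ^{n_t×T} be the weight matrices of a linear STBC, let L ≤ N, and let c : {1,…,L} → {1,…,g} assign each of the first L indices to one of g groups. Suppose that for every pair i, j ≤ L with c(i) ≠ c(j), the pair (A_i, A_j) satisfies the symmetrized trace conditions. Then for every number of receive antennas n_r and every channel matrix H ∈ ℂ^{n_r×n_t}, letting h_k^eq = ṽec(H·A_k) ∈ ℝ^{2 n_r T} and r_1,…,r_N the (unnormalized) Gram–Schmidt orthogonalization of h_1^eq,…,h_N^eq, one has ⟨r_i, h_j^eq⟩ = 0 for all i, j ≤ L with c(i) ≠ c(j). Hence the top-left L×L block of the R-factor of the QR decomposition of the equivalent channel matrix is block diagonal according to the partition, i.e. the code is fast sphere decodable, independently of H and n_r. -/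

import Mathlib

open Matrix Complex
open scoped RealInnerProductSpace ComplexConjugate

instance finWFLT (N : ℕ) : WellFoundedLT (Fin N) := inferInstance

/-- Realified (column-stacked) vectorization of a complex matrix. -/
noncomputable def tvec {m n : ℕ} (X : Matrix (Fin m) (Fin n) ℂ) :
    EuclideanSpace ℝ (Fin n × Fin m × Fin 2) :=
  WithLp.toLp 2 fun p => if p.2.2 = 0 then (X p.2.1 p.1).re else (X p.2.1 p.1).im

/-- The symmetrized trace conditions on a pair of complex `n_t × T` matrices. -/
def SymTraceCond {nt T : ℕ} (A B : Matrix (Fin nt) (Fin T) ℂ) : Prop :=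
  (∀ q p : Fin nt, q ≤ p →
    ∑ l : Fin T, (A q l * conj (B p l) + A p l * conj (B q l)).re = 0) ∧
  (∀ q p : Fin nt, q < p →
    ∑ l : Fin T, (Complex.I * (A q l * conj (B p l) - A p l * conj (B q l))).re = 0)

/-- If a family of vectors is orthogonal across the classes of a colouring, then any vector in the
span of one class is orthogonal to every vector of another class. -/
theorem inner_eq_zero_of_mem_span_class {α κ E : Type*}
    [NormedAddCommGroup E] [InnerProductSpace ℝ E] {v : α → E} {c : α → κ}
    (h : ∀ i j, c i ≠ c j → ⟪v i, v j⟫ = 0) {i j : α} (hij : c i ≠ c j) {x : E}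
    (hx : x ∈ Submodule.span ℝ (v '' {k | c k = c i})) : ⟪x, v j⟫ = 0 := by
  induction hx using Submodule.span_induction with
  | mem x hx =>
    obtain ⟨k, hk, rfl⟩ := hx
    exact h k j (ne_of_eq_of_ne hk hij)
  | zero => exact inner_zero_left _
  | add x y _ _ hx hy => rw [inner_add_left, hx, hy, add_zero]
  | smul a x _ hx => rw [real_inner_smul_left, hx, mul_zero]

open InnerProductSpace in
/-- If the vectors indexed by an initial segment are orthogonal across the classes of a colouring,
then each of their Gram–Schmidt vectors lies in the span of the vectors of its own class. -/
theorem gramSchmidt_mem_span_class {α ι κ E : Type*}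
    [LinearOrder α] [WellFoundedLT α] [LinearOrder ι] [LocallyFiniteOrderBot ι] [WellFoundedLT ι]
    [NormedAddCommGroup E] [InnerProductSpace ℝ E] (f : α ≤i ι) {v : ι → E} {c : α → κ}
    (h : ∀ i j, c i ≠ c j → ⟪v (f i), v (f j)⟫ = 0) (i : α) :
    gramSchmidt ℝ v (f i) ∈ Submodule.span ℝ ((fun k => v (f k)) '' {k | c k = c i}) := by
  induction i using WellFoundedLT.induction with
  | ind i ih =>
    rw [gramSchmidt_def]
    refine Submodule.sub_mem _ (Submodule.subset_span ⟨i, rfl, rfl⟩) (Submodule.sum_mem _ ?_)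
    intro k hk
    obtain ⟨k, rfl⟩ := f.mem_range_of_rel (Finset.mem_Iio.mp hk)
    have hki := ih k (f.lt_iff_lt.mp (Finset.mem_Iio.mp hk))
    rw [Submodule.starProjection_singleton]
    by_cases hc : c k = c i
    · exact Submodule.smul_mem _ _ (hc ▸ hki)
    · simp [inner_eq_zero_of_mem_span_class h hc hki]

/-- The realified vectorization turns the real part of the Frobenius product into the Euclidean
inner product. -/
theorem inner_tvec {m n : ℕ} (X Y : Matrix (Fin m) (Fin n) ℂ) :
    ⟪tvec X, tvec Y⟫ = (X * Yᴴ).trace.re := by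
  simp only [tvec, PiLp.inner_apply, Fintype.sum_prod_type, Fin.sum_univ_two, Matrix.trace,
    Matrix.diag, Matrix.mul_apply, Complex.re_sum]
  rw [Finset.sum_comm]
  simp [Complex.mul_re, mul_comm]

/-- The symmetrized trace conditions say that `A * Bᴴ` is skew-Hermitian. -/
theorem SymTraceCond.conjTranspose_mul {nt T : ℕ} {A B : Matrix (Fin nt) (Fin T) ℂ}
    (h : SymTraceCond A B) : (A * Bᴴ)ᴴ = -(A * Bᴴ) := by
  have re_im : ∀ q p, q ≤ p → ((A * Bᴴ) q p).re + ((A * Bᴴ) p q).re = 0 ∧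
      ((A * Bᴴ) q p).im = ((A * Bᴴ) p q).im := by
    intro q p hqp
    refine ⟨?_, ?_⟩
    · have := h.1 q p hqp
      rw [← Complex.re_sum, Finset.sum_add_distrib] at this
      simpa [Matrix.mul_apply] using this
    · rcases hqp.eq_or_lt with rfl | hlt
      · rfl
      · have := h.2 q p hlt
        rw [← Complex.re_sum, ← Finset.mul_sum, Finset.sum_sub_distrib, Complex.I_mul_re,
          Complex.sub_im, neg_eq_zero, sub_eq_zero] at this
        simpa only [Matrix.mul_apply, Matrix.conjTranspose_apply, Complex.star_def] using this
  ext q p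
  rw [Matrix.conjTranspose_apply, Matrix.neg_apply]
  rcases le_total q p with hqp | hqp <;> obtain ⟨hre, him⟩ := re_im _ _ hqp <;>
    apply Complex.ext <;> simp only [Complex.star_def, Complex.conj_re, Complex.conj_im,
      Complex.neg_re, Complex.neg_im] <;> linarith

/-- The symmetrized trace conditions make the equivalent channel vectors orthogonal. -/
theorem SymTraceCond.inner_tvec_mul {nr nt T : ℕ} {A B : Matrix (Fin nt) (Fin T) ℂ}
    (h : SymTraceCond A B) (H : Matrix (Fin nr) (Fin nt) ℂ) :
    ⟪tvec (H * A), tvec (H * B)⟫ = 0 := by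
  have hM : H * A * (H * B)ᴴ = H * (A * Bᴴ) * Hᴴ := by
    simp only [Matrix.conjTranspose_mul, Matrix.mul_assoc]
  have hstar : star (H * (A * Bᴴ) * Hᴴ).trace = -(H * (A * Bᴴ) * Hᴴ).trace := by
    rw [← Matrix.trace_conjTranspose, Matrix.conjTranspose_mul, Matrix.conjTranspose_mul,
      h.conjTranspose_mul, Matrix.conjTranspose_conjTranspose, Matrix.neg_mul, Matrix.mul_neg,
      Matrix.trace_neg, ← Matrix.mul_assoc]
  rw [inner_tvec, hM]
  have := congrArg Complex.re hstar
  rw [Complex.star_def, Complex.conj_re, Complex.neg_re] at this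
  linarith

/-- fast decodability: if the first `L` weight matrices are partitioned into
`g` groups and the symmetrized trace conditions hold for every pair among them lying in
different groups, then for every `n_r` and `H`, the Gram–Schmidt vectors `r_i` of the
columns `h_k^eq = ṽec(H·A_k)` satisfy `⟨r_i, h_j^eq⟩ = 0` for all `i, j ≤ L` in different
groups: the top-left `L×L` block of the `R`-factor is block diagonal (the code is fast
sphere decodable), independently of `H` and `n_r`. -/
theorem stmt14 (nt T N L g : ℕ) (hL : L ≤ N)
    (A : Fin N → Matrix (Fin nt) (Fin T) ℂ) (c : Fin L → Fin g)
    (h : ∀ i j : Fin L, c i ≠ c j →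
      SymTraceCond (A (Fin.castLE hL i)) (A (Fin.castLE hL j))) :
    ∀ (nr : ℕ) (H : Matrix (Fin nr) (Fin nt) ℂ) (i j : Fin L), c i ≠ c j →
      ⟪InnerProductSpace.gramSchmidt ℝ (fun k => tvec (H * A k)) (Fin.castLE hL i),
        tvec (H * A (Fin.castLE hL j))⟫ = 0 := by
  intro nr H i j hij
  let f : Fin L ≤i Fin N :=
    { toFun := Fin.castLE hL
      inj' := Fin.castLE_injective hL
      map_rel_iff' := Iff.rfl
      mem_range_of_rel' := fun a b hb =>
        ⟨⟨b, lt_trans (show (b : ℕ) < a from hb) a.isLt⟩, rfl⟩ }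
  have hv : ∀ i j, c i ≠ c j → ⟪tvec (H * A (f i)), tvec (H * A (f j))⟫ = 0 :=
    fun i j hij => (h i j hij).inner_tvec_mul H
  exact inner_eq_zero_of_mem_span_class hv hij
    (gramSchmidt_mem_span_class f (v := fun k => tvec (H * A k)) hv i)
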